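/- For (t,m) ∈ [0,T] × 𝒫₂ and partitions π = {t = t₁ < ... < t_N = T}, define M̂_{t₁} = m and M̂_{t_q} = p^{t_{q−1}, M_{t_{q−1}}}_{t_q} for q = 2,...,N. Then both sup_{M ∈ 𝓜(t,m)} E[ Σ_{q=1}^{N−1} (t_{q+1} − t_q) d₁(M_{t_q}, M̂_{t_q}) ] and sup_{M ∈ 𝓜(t,m)} E[ Σ_{q=1}^{N−1} (t_{q+1} − t_q) d₁(M_{t_{q+1}}, M̂_{t_{q+1}}) ] converge to 0 as the mesh |π| of the partition tends to 0. -/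

import Mathlib

open MeasureTheory Filter Set
open scoped Topology ENNReal NNReal BoundedContinuousFunction

noncomputable section

/-- Euclidean space `ℝ^d`. -/
abbrev Ed (d : ℕ) : Type := EuclideanSpace ℝ (Fin d)

/-- `m ∈ 𝒫_p` : Borel probability measure on `ℝ^d` with finite `p`-th moment. -/
def MemP (d : ℕ) (p : ℝ) (m : Measure (Ed d)) : Prop :=
  IsProbabilityMeasure m ∧ Integrable (fun x => ‖x‖ ^ p) m

/-- `γ` is a coupling of `m` and `m'`. -/
def IsCoupling (d : ℕ) (γ : Measure (Ed d × Ed d)) (m m' : Measure (Ed d)) : Prop :=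
  γ.map Prod.fst = m ∧ γ.map Prod.snd = m'

/-- The `p`-Wasserstein distance. -/
def wdist (d : ℕ) (p : ℝ) (m m' : Measure (Ed d)) : ℝ :=
  sInf { c : ℝ | ∃ γ : Measure (Ed d × Ed d), IsProbabilityMeasure γ ∧ IsCoupling d γ m m' ∧
      c = (∫ q, ‖q.1 - q.2‖ ^ p ∂γ) ^ (1 / p) }

/-- The Gaussian kernel `ρ_δ`. -/
def gaussDensity (d : ℕ) (δ : ℝ) (x : Ed d) : ℝ :=
  (2 * Real.pi * δ) ^ (-(d : ℝ) / 2) * Real.exp (-‖x‖ ^ 2 / (2 * δ))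

/-- The centered Gaussian measure with variance `δ` on `ℝ^d`. -/
def gaussMeasure (d : ℕ) (δ : ℝ) : Measure (Ed d) :=
  volume.withDensity fun x => ENNReal.ofReal (gaussDensity d δ x)

/-- The heat flow `p^{t,m}_s` : the law at time `s` of a Brownian motion started
at time `t` with initial law `m`. -/
def heatFlow (d : ℕ) (t s : ℝ) (m : Measure (Ed d)) : Measure (Ed d) :=
  if s ≤ t then m
  else Measure.map (fun q : Ed d × Ed d => q.1 + q.2) (m.prod (gaussMeasure d (s - t)))

/-- The natural filtration of a measure-valued process, made right-continuous:
`𝓕^M_s = ⋂_{u > s} σ(M_r, r ∈ [t,u])`. -/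
def genFiltration {Ω : Type} (d : ℕ) (M : ℝ → Ω → Measure (Ed d)) (t s : ℝ) :
    MeasurableSpace Ω :=
  ⨅ u ∈ Set.Ioi s, ⨆ r ∈ Set.Icc t u, MeasurableSpace.comap (M r) inferInstance

/-- A path `[t,T] → (𝒫₁,d₁)` is càdlàg: right-continuous with left limits (for `d₁`). -/
def CadlagD1 (d : ℕ) (t T : ℝ) (g : ℝ → Measure (Ed d)) : Prop :=
  (∀ s ∈ Set.Ico t T, Tendsto (fun r => wdist d 1 (g r) (g s)) (𝓝[Set.Ici s] s) (𝓝 0)) ∧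
  (∀ s ∈ Set.Ioc t T, ∃ μ : Measure (Ed d),
      Tendsto (fun r => wdist d 1 (g r) μ) (𝓝[Set.Ico t s] s) (𝓝 0))

/-- An element of `𝓜(t,m)` : a càdlàg `(𝒫₁,d₁)`-valued process `M = (M_s)_{s∈[t,T]}`
on some probability space such that (i) `E[M_t(φ)] = m(φ)` for all bounded continuous `φ`
and (ii) `E[M_{t₂}(φ) | 𝓕^M_{t₁}] = p^{t₁,M_{t₁}}_{t₂}(φ)` for all `t ≤ t₁ ≤ t₂ ≤ T` and
all bounded continuous `φ`. -/
structure MVP (d : ℕ) (T t : ℝ) (m : Measure (Ed d)) where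
  Ω : Type
  mΩ : MeasurableSpace Ω
  P : @Measure Ω mΩ
  probP : IsProbabilityMeasure P
  M : ℝ → Ω → Measure (Ed d)
  meas : ∀ s, @Measurable Ω (Measure (Ed d)) mΩ inferInstance (M s)
  inP1 : ∀ s ∈ Set.Icc t T, ∀ ω, MemP d 1 (M s ω)
  cadlag : ∀ ω, CadlagD1 d t T (fun s => M s ω)
  init : ∀ φ : Ed d →ᵇ ℝ, ∫ ω, (∫ x, φ x ∂(M t ω)) ∂P = ∫ x, φ x ∂m
  cond : ∀ t₁ t₂ : ℝ, t ≤ t₁ → t₁ ≤ t₂ → t₂ ≤ T → ∀ φ : Ed d →ᵇ ℝ,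
    P[(fun ω => ∫ x, φ x ∂(M t₂ ω)) | genFiltration d M t t₁]
      =ᵐ[P] fun ω => ∫ x, φ x ∂(heatFlow d t₁ t₂ (M t₁ ω))

lemma wdist_le_of_coupling {d : ℕ} {μ ν : Measure (Ed d)} (γ : Measure (Ed d × Ed d))
    [IsProbabilityMeasure γ] (hγ : IsCoupling d γ μ ν) {c : ℝ} (hc : 0 ≤ c)
    (h : ∫⁻ q, ‖q.1 - q.2‖ₑ ∂γ ≤ ENNReal.ofReal c) : wdist d 1 μ ν ≤ c := by
  have h1 : ∫ q, ‖q.1 - q.2‖ ∂γ ≤ c := by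
    rw [integral_norm_eq_lintegral_enorm (by fun_prop)]
    exact ENNReal.toReal_le_of_le_ofReal hc h
  refine csInf_le_of_le ⟨0, ?_⟩ ⟨γ, inferInstance, hγ, rfl⟩ (by simpa using h1)
  rintro _ ⟨γ', _, _, rfl⟩
  positivity

lemma wdist_nonneg {d : ℕ} {p : ℝ} (μ ν : Measure (Ed d)) : 0 ≤ wdist d p μ ν := by
  refine Real.sInf_nonneg ?_
  rintro _ ⟨γ', _, _, rfl⟩
  positivity

/-- The part of `μ` left over after removing the fractions `c i` of the pieces `χ i • μ`. -/
def residualMeasure {d : ℕ} {ι : Type*} [Fintype ι] (μ : Measure (Ed d)) (χ : ι → Ed d → ℝ)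
    (c : ι → ℝ) : Measure (Ed d) :=
  μ.withDensity fun x => ENNReal.ofReal (1 - ∑ i, c i * χ i x)

section residualMeasure

variable {d : ℕ} {ι : Type*} [Fintype ι] {μ : Measure (Ed d)} {χ : ι → Ed d → ℝ} {c : ι → ℝ}

lemma sum_mul_le_one (h0 : ∀ i x, 0 ≤ χ i x) (h1 : ∀ x, ∑ i, χ i x ≤ 1)
    (hc1 : ∀ i, c i ≤ 1) (x : Ed d) : ∑ i, c i * χ i x ≤ 1 :=
  (Finset.sum_le_sum fun i _ => mul_le_of_le_one_left (h0 i x) (hc1 i)).trans (h1 x)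

lemma sum_add_residualMeasure (hχ : ∀ i, Measurable (χ i)) (h0 : ∀ i x, 0 ≤ χ i x)
    (h1 : ∀ x, ∑ i, χ i x ≤ 1) (hc0 : ∀ i, 0 ≤ c i) (hc1 : ∀ i, c i ≤ 1) :
    ∑ i, ENNReal.ofReal (c i) • μ.withDensity (fun x => ENNReal.ofReal (χ i x))
      + residualMeasure μ χ c = μ := by
  have h2 : ∀ i, ENNReal.ofReal (c i) • μ.withDensity (fun x => ENNReal.ofReal (χ i x))
      = μ.withDensity (fun x => ENNReal.ofReal (c i * χ i x)) := fun i => by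
    rw [← withDensity_smul _ (hχ i).ennreal_ofReal]
    congr 1
    ext x
    simp [ENNReal.ofReal_mul (hc0 i)]
  simp_rw [h2]
  ext s hs
  rw [Measure.add_apply, Measure.finsetSum_apply, residualMeasure, withDensity_apply _ hs]
  simp_rw [withDensity_apply _ hs]
  rw [← lintegral_finsetSum _ (fun i _ => by fun_prop), ← lintegral_add_left (by fun_prop)]
  rw [← setLIntegral_one]
  refine lintegral_congr fun x => ?_
  rw [← ENNReal.ofReal_sum_of_nonneg (fun i _ => mul_nonneg (hc0 i) (h0 i x)),
    ← ENNReal.ofReal_add (Finset.sum_nonneg fun i _ => mul_nonneg (hc0 i) (h0 i x))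
      (sub_nonneg.2 (sum_mul_le_one h0 h1 hc1 x))]
  simp

variable [IsProbabilityMeasure μ]

lemma integrable_of_sum_le_one (hχ : ∀ i, Measurable (χ i)) (h0 : ∀ i x, 0 ≤ χ i x)
    (h1 : ∀ x, ∑ i, χ i x ≤ 1) (i : ι) : Integrable (χ i) μ := by
  refine .of_bound (hχ i).aestronglyMeasurable 1 (.of_forall fun x => ?_)
  rw [Real.norm_of_nonneg (h0 i x)]
  exact (Finset.single_le_sum (f := fun i => χ i x) (fun i _ => h0 i x)
    (Finset.mem_univ i)).trans (h1 x)

lemma residualMeasure_univ (hχ : ∀ i, Measurable (χ i)) (h0 : ∀ i x, 0 ≤ χ i x)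
    (h1 : ∀ x, ∑ i, χ i x ≤ 1) (hc1 : ∀ i, c i ≤ 1) :
    residualMeasure μ χ c univ = ENNReal.ofReal (1 - ∑ i, c i * ∫ x, χ i x ∂μ) := by
  have hi := integrable_of_sum_le_one (μ := μ) hχ h0 h1
  have hint : Integrable (fun x => 1 - ∑ i, c i * χ i x) μ :=
    (integrable_const _).sub (integrable_finsetSum _ fun i _ => (hi i).const_mul _)
  rw [residualMeasure, withDensity_apply _ .univ, setLIntegral_univ,
    ← ofReal_integral_eq_lintegral_ofReal hint
    (.of_forall fun x => sub_nonneg.2 (sum_mul_le_one h0 h1 hc1 x)),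
    integral_sub (integrable_const _) (integrable_finsetSum _ fun i _ => (hi i).const_mul _),
    integral_finsetSum _ fun i _ => (hi i).const_mul _]
  simp [integral_const_mul]

lemma lintegral_enorm_residualMeasure_le (hχ : ∀ i, Measurable (χ i)) (h0 : ∀ i x, 0 ≤ χ i x)
    (h1 : ∀ x, ∑ i, χ i x ≤ 1) (hc0 : ∀ i, 0 ≤ c i) (hc1 : ∀ i, c i ≤ 1) {R K : ℝ} (hR : 0 < R)
    (hsum : ∀ x, ‖x‖ ≤ R → ∑ i, χ i x = 1) (hK : ∀ i x, χ i x ≠ 0 → ‖x‖ ≤ K) (hK0 : 0 ≤ K)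
    (hμ : Integrable (fun x => ‖x‖ ^ 2) μ) :
    ∫⁻ x, ‖x‖ₑ ∂(residualMeasure μ χ c) ≤
      ENNReal.ofReal (R⁻¹ * ∫ x, ‖x‖ ^ 2 ∂μ + K * ∑ i, (1 - c i) * ∫ x, χ i x ∂μ) := by
  have hi := integrable_of_sum_le_one (μ := μ) hχ h0 h1
  have hp : ∀ x, ‖x‖ * (1 - ∑ i, c i * χ i x) ≤ R⁻¹ * ‖x‖ ^ 2 + K * ∑ i, (1 - c i) * χ i x := by
    intro x
    have hs : 0 ≤ ∑ i, c i * χ i x := Finset.sum_nonneg fun i _ => mul_nonneg (hc0 i) (h0 i x)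
    rcases le_or_gt ‖x‖ R with hx | hx
    · have e1 : ‖x‖ * (1 - ∑ i, c i * χ i x) = ∑ i, (1 - c i) * (‖x‖ * χ i x) := by
        conv_lhs => rw [← hsum x hx, ← Finset.sum_sub_distrib, Finset.mul_sum]
        exact Finset.sum_congr rfl fun i _ => by ring
      rw [e1, Finset.mul_sum]
      refine le_add_of_nonneg_of_le (by positivity) (Finset.sum_le_sum fun i _ => ?_)
      have : ‖x‖ * χ i x ≤ K * χ i x := by
        by_cases hx0 : χ i x = 0
        · simp [hx0]
        · exact mul_le_mul_of_nonneg_right (hK i x hx0) (h0 i x)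
      nlinarith [hc1 i]
    · have h2 : ‖x‖ ≤ R⁻¹ * ‖x‖ ^ 2 := by
        rw [inv_mul_eq_div, le_div_iff₀ hR]
        nlinarith [norm_nonneg x]
      have h3 : 0 ≤ K * ∑ i, (1 - c i) * χ i x := mul_nonneg hK0
        (Finset.sum_nonneg fun i _ => mul_nonneg (sub_nonneg.2 (hc1 i)) (h0 i x))
      nlinarith [norm_nonneg x]
  have hint : Integrable (fun x => ∑ i, (1 - c i) * χ i x) μ :=
    integrable_finsetSum _ fun i _ => (hi i).const_mul _
  have e2 : R⁻¹ * ∫ x, ‖x‖ ^ 2 ∂μ + K * ∑ i, (1 - c i) * ∫ x, χ i x ∂μ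
      = ∫ x, R⁻¹ * ‖x‖ ^ 2 + K * ∑ i, (1 - c i) * χ i x ∂μ := by
    rw [integral_add (hμ.const_mul _) (hint.const_mul _), integral_const_mul, integral_const_mul,
      integral_finsetSum _ fun i _ => (hi i).const_mul _]
    simp [integral_const_mul]
  have hint' : Integrable (fun x => R⁻¹ * ‖x‖ ^ 2 + K * ∑ i, (1 - c i) * χ i x) μ :=
    (hμ.const_mul _).add (hint.const_mul _)
  rw [e2, ofReal_integral_eq_lintegral_ofReal hint'
    (.of_forall fun x => (mul_nonneg (norm_nonneg x)
      (sub_nonneg.2 (sum_mul_le_one h0 h1 hc1 x))).trans (hp x)), residualMeasure,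
    lintegral_withDensity_eq_lintegral_mul _ (by fun_prop) (by fun_prop)]
  refine lintegral_mono fun x => ?_
  rw [Pi.mul_apply, ← ofReal_norm, mul_comm, ← ENNReal.ofReal_mul (norm_nonneg x)]
  exact ENNReal.ofReal_le_ofReal (hp x)

end residualMeasure

/-- Two finite measures of equal mass have a coupling with cost at most the sum of their first
moments. -/
lemma exists_product_coupling {d : ℕ} (μ ν : Measure (Ed d)) [IsFiniteMeasure μ]
    [IsFiniteMeasure ν] (h : μ univ = ν univ) :
    ∃ γ : Measure (Ed d × Ed d), γ.map Prod.fst = μ ∧ γ.map Prod.snd = ν ∧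
      ∫⁻ q, ‖q.1 - q.2‖ₑ ∂γ ≤ ∫⁻ x, ‖x‖ₑ ∂μ + ∫⁻ x, ‖x‖ₑ ∂ν := by
  by_cases h0 : μ univ = 0
  · have hμ : μ = 0 := by simpa using h0
    have hν : ν = 0 := by rw [h] at h0; simpa using h0
    exact ⟨0, by simp [hμ, hν]⟩
  have hinv : (μ univ)⁻¹ * μ univ = 1 := ENNReal.inv_mul_cancel h0 (measure_ne_top _ _)
  refine ⟨(μ univ)⁻¹ • μ.prod ν, ?_, ?_, ?_⟩
  · rw [Measure.map_smul, Measure.map_fst_prod, ← h, smul_smul, hinv, one_smul]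
  · rw [Measure.map_smul, Measure.map_snd_prod, smul_smul, hinv, one_smul]
  · calc ∫⁻ q, ‖q.1 - q.2‖ₑ ∂((μ univ)⁻¹ • μ.prod ν)
        = (μ univ)⁻¹ * ∫⁻ q, ‖q.1 - q.2‖ₑ ∂(μ.prod ν) := by rw [lintegral_smul_measure]; rfl
      _ ≤ (μ univ)⁻¹ * ∫⁻ q, (‖q.1‖ₑ + ‖q.2‖ₑ) ∂(μ.prod ν) := by
          gcongr with q
          exact enorm_sub_le
      _ = (μ univ)⁻¹ * (μ univ * (∫⁻ x, ‖x‖ₑ ∂μ + ∫⁻ x, ‖x‖ₑ ∂ν)) := by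
          rw [lintegral_add_left (by fun_prop), lintegral_prod _ (by fun_prop),
            lintegral_prod _ (by fun_prop)]
          simp only [lintegral_const, ← h]
          rw [lintegral_mul_const _ (by fun_prop)]
          ring
      _ ≤ _ := by rw [← mul_assoc, hinv, one_mul]

lemma exists_coupling_weight {a b : ℝ} (ha : 0 ≤ a) (hb : 0 ≤ b) :
    ∃ e : ℝ, 0 ≤ e ∧ e * a ≤ 1 ∧ e * b ≤ 1 ∧ e * a * b = min a b := by
  rcases le_total a b with h | h
  · rcases hb.eq_or_lt with rfl | hb'
    · exact ⟨0, by simp [le_antisymm h ha]⟩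
    · refine ⟨b⁻¹, by positivity, ?_, ?_, ?_⟩
      · rw [inv_mul_le_iff₀ hb']; simpa
      · rw [inv_mul_cancel₀ hb'.ne']
      · rw [min_eq_left h]; field_simp
  · rcases ha.eq_or_lt with rfl | ha'
    · exact ⟨0, by simp [le_antisymm h hb]⟩
    · refine ⟨a⁻¹, by positivity, ?_, ?_, ?_⟩
      · rw [inv_mul_cancel₀ ha'.ne']
      · rw [inv_mul_le_iff₀ ha']; simpa
      · rw [min_eq_right h]; field_simp

/-- The first Wasserstein distance is controlled by finitely many test functions supported in
small sets, together with the second moments. -/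
lemma wdist_one_le {d : ℕ} {ι : Type*} [Fintype ι] {μ ν : Measure (Ed d)}
    [IsProbabilityMeasure μ] [IsProbabilityMeasure ν] {χ : ι → Ed d → ℝ}
    (hχ : ∀ i, Measurable (χ i)) (h0 : ∀ i x, 0 ≤ χ i x)
    (h1 : ∀ x, ∑ i, χ i x ≤ 1) {R K ε : ℝ} (hR : 0 < R) (hε : 0 ≤ ε)
    (hsum : ∀ x, ‖x‖ ≤ R → ∑ i, χ i x = 1) (hK : ∀ i x, χ i x ≠ 0 → ‖x‖ ≤ K) (hK0 : 0 ≤ K)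
    (hdiam : ∀ i x y, χ i x ≠ 0 → χ i y ≠ 0 → ‖x - y‖ ≤ ε)
    (hμ : Integrable (fun x => ‖x‖ ^ 2) μ) (hν : Integrable (fun x => ‖x‖ ^ 2) ν) :
    wdist d 1 μ ν ≤ ε + K * ∑ i, |∫ x, χ i x ∂μ - ∫ x, χ i x ∂ν|
      + R⁻¹ * (∫ x, ‖x‖ ^ 2 ∂μ + ∫ x, ‖x‖ ^ 2 ∂ν) := by
  set a : ι → ℝ := fun i => ∫ x, χ i x ∂μ with ha
  set b : ι → ℝ := fun i => ∫ x, χ i x ∂ν with hb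
  have ha0 : ∀ i, 0 ≤ a i := fun i => integral_nonneg (h0 i)
  have hb0 : ∀ i, 0 ≤ b i := fun i => integral_nonneg (h0 i)
  have hiμ := integrable_of_sum_le_one (μ := μ) hχ h0 h1
  have hiν := integrable_of_sum_le_one (μ := ν) hχ h0 h1
  choose e he0 hea heb hmin using fun i => exists_coupling_weight (ha0 i) (hb0 i)
  set μi : ι → Measure (Ed d) := fun i => μ.withDensity (fun x => ENNReal.ofReal (χ i x)) with hμi
  set νi : ι → Measure (Ed d) := fun i => ν.withDensity (fun x => ENNReal.ofReal (χ i x)) with hνi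
  have hmμ : ∀ i, μi i univ = ENNReal.ofReal (a i) := fun i => by
    rw [hμi, withDensity_apply _ .univ, setLIntegral_univ,
      ← ofReal_integral_eq_lintegral_ofReal (hiμ i) (.of_forall (h0 i))]
  have hmν : ∀ i, νi i univ = ENNReal.ofReal (b i) := fun i => by
    rw [hνi, withDensity_apply _ .univ, setLIntegral_univ,
      ← ofReal_integral_eq_lintegral_ofReal (hiν i) (.of_forall (h0 i))]
  have : ∀ i, IsFiniteMeasure (μi i) := fun i => ⟨by simp [hmμ]⟩
  have : ∀ i, IsFiniteMeasure (νi i) := fun i => ⟨by simp [hmν]⟩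
  have hceb : ∀ i, 0 ≤ e i * b i := fun i => mul_nonneg (he0 i) (hb0 i)
  have hcea : ∀ i, 0 ≤ e i * a i := fun i => mul_nonneg (he0 i) (ha0 i)
  set μ' := residualMeasure μ χ (fun i => e i * b i) with hμ'
  set ν' := residualMeasure ν χ (fun i => e i * a i) with hν'
  have hrμ : μ' univ = ENNReal.ofReal (1 - ∑ i, min (a i) (b i)) := by
    rw [hμ', residualMeasure_univ hχ h0 h1 heb]
    simp_rw [← hmin]
    congr! 3 with i
    ring
  have hrν : ν' univ = ENNReal.ofReal (1 - ∑ i, min (a i) (b i)) := by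
    rw [hν', residualMeasure_univ hχ h0 h1 hea]
    simp_rw [← hmin]
    rfl
  have : IsFiniteMeasure μ' := ⟨by simp [hrμ]⟩
  have : IsFiniteMeasure ν' := ⟨by simp [hrν]⟩
  obtain ⟨γ', hγ1, hγ2, hγc⟩ := exists_product_coupling μ' ν' (hrμ.trans hrν.symm)
  set γ : Measure (Ed d × Ed d) := ∑ i, ENNReal.ofReal (e i) • (μi i).prod (νi i) + γ' with hγ
  have hm1 : γ.map Prod.fst = μ := by
    rw [hγ, Measure.map_add _ _ measurable_fst, Measure.map_finset_sum measurable_fst.aemeasurable,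
      hγ1]
    rw [← sum_add_residualMeasure (μ := μ) hχ h0 h1 hceb heb]
    congr 1
    refine Finset.sum_congr rfl fun i _ => ?_
    rw [Measure.map_smul, Measure.map_fst_prod, hmν, smul_smul, ENNReal.ofReal_mul (he0 i)]
  have hm2 : γ.map Prod.snd = ν := by
    rw [hγ, Measure.map_add _ _ measurable_snd, Measure.map_finset_sum measurable_snd.aemeasurable,
      hγ2]
    rw [← sum_add_residualMeasure (μ := ν) hχ h0 h1 hcea hea]
    congr 1
    refine Finset.sum_congr rfl fun i _ => ?_
    rw [Measure.map_smul, Measure.map_snd_prod, hmμ, smul_smul, ENNReal.ofReal_mul (he0 i)]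
  have : IsProbabilityMeasure γ := by
    refine ⟨?_⟩
    rw [← Set.preimage_univ (f := Prod.fst), ← Measure.map_apply measurable_fst .univ, hm1]
    exact measure_univ
  have hpiece : ∀ i, ∫⁻ q, ‖q.1 - q.2‖ₑ ∂((μi i).prod (νi i)) ≤
      ENNReal.ofReal ε * (ENNReal.ofReal (a i) * ENNReal.ofReal (b i)) := fun i => by
    rw [lintegral_prod _ (by fun_prop)]
    calc ∫⁻ x, ∫⁻ y, ‖x - y‖ₑ ∂(νi i) ∂(μi i)
        ≤ ∫⁻ _, ∫⁻ _, ENNReal.ofReal ε ∂(νi i) ∂(μi i) := by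
          have hae : ∀ (κ : Measure (Ed d)), ∀ᵐ x ∂κ.withDensity (fun x => ENNReal.ofReal (χ i x)),
              χ i x ≠ 0 := fun κ => by
            rw [ae_withDensity_iff (by fun_prop)]
            exact .of_forall fun x hx hx' => hx (by simp [hx'])
          refine lintegral_mono_ae ?_
          filter_upwards [hae μ] with x hx
          refine lintegral_mono_ae ?_
          filter_upwards [hae ν] with y hy
          rw [← ofReal_norm]
          exact ENNReal.ofReal_le_ofReal (hdiam i x y hx hy)
      _ = _ := by simp [hmμ, hmν, mul_comm, mul_left_comm]
  have hsum1 : ∑ i, min (a i) (b i) ≤ 1 := by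
    calc ∑ i, min (a i) (b i) ≤ ∑ i, a i := Finset.sum_le_sum fun i _ => min_le_left _ _
      _ = ∫ x, ∑ i, χ i x ∂μ := (integral_finsetSum _ fun i _ => hiμ i).symm
      _ ≤ ∫ _, (1 : ℝ) ∂μ := integral_mono (integrable_finsetSum _ fun i _ => hiμ i)
          (integrable_const _) h1
      _ = 1 := by simp
  have hSμ : 0 ≤ ∫ x, ‖x‖ ^ 2 ∂μ := integral_nonneg fun x => by positivity
  have hSν : 0 ≤ ∫ x, ‖x‖ ^ 2 ∂ν := integral_nonneg fun x => by positivity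
  have hkey : ∑ i, (1 - e i * b i) * a i + ∑ i, (1 - e i * a i) * b i = ∑ i, |a i - b i| := by
    rw [← Finset.sum_add_distrib]
    refine Finset.sum_congr rfl fun i _ => ?_
    have := hmin i
    rcases le_total (a i) (b i) with h | h
    · rw [abs_of_nonpos (by linarith)]; rw [min_eq_left h] at this; linear_combination -2 * this
    · rw [abs_of_nonneg (by linarith)]; rw [min_eq_right h] at this; linear_combination -2 * this
  have hA : 0 ≤ ∑ i, (1 - e i * b i) * a i :=
    Finset.sum_nonneg fun i _ => mul_nonneg (sub_nonneg.2 (heb i)) (ha0 i)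
  have hB : 0 ≤ ∑ i, (1 - e i * a i) * b i :=
    Finset.sum_nonneg fun i _ => mul_nonneg (sub_nonneg.2 (hea i)) (hb0 i)
  have hcost : ∫⁻ q, ‖q.1 - q.2‖ₑ ∂γ ≤ ENNReal.ofReal (ε +
      ((R⁻¹ * ∫ x, ‖x‖ ^ 2 ∂μ + K * ∑ i, (1 - e i * b i) * a i) +
      (R⁻¹ * ∫ x, ‖x‖ ^ 2 ∂ν + K * ∑ i, (1 - e i * a i) * b i))) := by
    rw [hγ, lintegral_add_measure, lintegral_finsetSum_measure,
      ENNReal.ofReal_add hε (by positivity), ENNReal.ofReal_add (by positivity) (by positivity)]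
    refine add_le_add ?_ (hγc.trans (add_le_add
      (lintegral_enorm_residualMeasure_le hχ h0 h1 hceb heb hR hsum hK hK0 hμ)
      (lintegral_enorm_residualMeasure_le hχ h0 h1 hcea hea hR hsum hK hK0 hν)))
    calc ∑ i, ∫⁻ q, ‖q.1 - q.2‖ₑ ∂(ENNReal.ofReal (e i) • (μi i).prod (νi i))
        ≤ ∑ i, ENNReal.ofReal (ε * min (a i) (b i)) := by
          refine Finset.sum_le_sum fun i _ => ?_
          rw [lintegral_smul_measure, ← hmin, ENNReal.ofReal_mul hε, ENNReal.ofReal_mul (hcea i),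
            ENNReal.ofReal_mul (he0 i), smul_eq_mul]
          calc _ ≤ ENNReal.ofReal (e i) * (ENNReal.ofReal ε *
                (ENNReal.ofReal (a i) * ENNReal.ofReal (b i))) := by gcongr; exact hpiece i
            _ = _ := by ring
      _ = ENNReal.ofReal (ε * ∑ i, min (a i) (b i)) := by
          rw [Finset.mul_sum, ENNReal.ofReal_sum_of_nonneg fun i _ =>
            mul_nonneg hε (le_min (ha0 i) (hb0 i))]
      _ ≤ ENNReal.ofReal ε := ENNReal.ofReal_le_ofReal (mul_le_of_le_one_right hε hsum1)
  refine (wdist_le_of_coupling γ ⟨hm1, hm2⟩ (by positivity) hcost).trans (le_of_eq ?_)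
  rw [← hkey]
  ring

/-- Smooth test functions subordinate to small balls and summing to one on a given ball. -/
lemma exists_smooth_partition (d : ℕ) (R : ℝ) {ε : ℝ} (hε : 0 < ε) :
    ∃ (ι : Type) (_ : Fintype ι) (χ : ι → Ed d → ℝ), (∀ i, ContDiff ℝ 2 (χ i)) ∧
      (∀ i, HasCompactSupport (χ i)) ∧ (∀ i x, 0 ≤ χ i x) ∧ (∀ x, ∑ i, χ i x ≤ 1) ∧
      (∀ x, ‖x‖ ≤ R → ∑ i, χ i x = 1) ∧
      (∀ i x y, χ i x ≠ 0 → χ i y ≠ 0 → ‖x - y‖ ≤ ε) := by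
  obtain ⟨c, -, hfin, hcov⟩ := (isCompact_closedBall (0 : Ed d) R).finite_cover_balls
    (half_pos hε)
  have : Fintype c := hfin.fintype
  obtain ⟨f, hf⟩ := SmoothPartitionOfUnity.exists_isSubordinate (modelWithCornersSelf ℝ (Ed d))
    (Metric.isClosed_closedBall (x := (0 : Ed d)) (ε := R))
    (fun i : c => Metric.ball (i : Ed d) (ε / 2)) (fun i => Metric.isOpen_ball)
    (by simpa [iUnion_coe_set] using hcov)
  have hball : ∀ (i : c) x, f i x ≠ 0 → x ∈ Metric.ball (i : Ed d) (ε / 2) := fun i x hx =>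
    hf i (subset_tsupport _ hx)
  refine ⟨c, inferInstance, fun i => f i, fun i => ?_, fun i => ?_, fun i x => f.nonneg i x,
    fun x => ?_, fun x hx => ?_, fun i x y hx hy => ?_⟩
  · exact (contMDiff_iff_contDiff.1 (f i).contMDiff).of_le
      (WithTop.coe_le_coe.2 (le_top : (2 : ℕ∞) ≤ ⊤))
  · exact (isCompact_closedBall (i : Ed d) (ε / 2)).of_isClosed_subset (isClosed_tsupport _)
      ((hf i).trans Metric.ball_subset_closedBall)
  · rw [← finsum_eq_sum_of_fintype]
    exact f.sum_le_one x
  · rw [← finsum_eq_sum_of_fintype]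
    exact f.sum_eq_one (by simpa using hx)
  · rw [← dist_eq_norm]
    have h1 := hball i x hx
    have h2 := hball i y hy
    rw [Metric.mem_ball] at h1 h2
    linarith [dist_triangle_right x y (i : Ed d)]

lemma exists_norm_le_of_hasCompactSupport {d : ℕ} {ι : Type} [Fintype ι] {χ : ι → Ed d → ℝ}
    (h : ∀ i, HasCompactSupport (χ i)) : ∃ K : ℝ, 0 ≤ K ∧ ∀ i x, χ i x ≠ 0 → ‖x‖ ≤ K := by
  obtain ⟨K, hK⟩ := (isCompact_iUnion fun i => (h i).isCompact).exists_bound_of_continuousOn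
    (f := fun x => x) continuousOn_id
  exact ⟨max K 0, le_max_right _ _, fun i x hx =>
    (hK x (mem_iUnion.2 ⟨i, subset_tsupport _ hx⟩)).trans (le_max_left _ _)⟩

lemma exists_taylor_bound {d : ℕ} {χ : Ed d → ℝ} (h : ContDiff ℝ 2 χ)
    (hc : HasCompactSupport χ) :
    ∃ c : ℝ, 0 ≤ c ∧ ∀ x y, |χ (x + y) - χ x - fderiv ℝ χ x y| ≤ c * ‖y‖ ^ 2 := by
  obtain ⟨C, hC⟩ := ContDiff.lipschitzWith_of_hasCompactSupport (hc.fderiv ℝ)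
    (h.fderiv_right (m := 1) (by norm_num)) one_ne_zero
  refine ⟨C, C.2, fun x y => ?_⟩
  have hxy : x + y ∈ Metric.closedBall x ‖y‖ := by simp
  have := (convex_closedBall x ‖y‖).norm_image_sub_le_of_norm_hasFDerivWithin_le'
    (f := χ) (f' := fderiv ℝ χ) (φ := fderiv ℝ χ x) (C := C * ‖y‖)
    (fun z _ => (h.differentiable (by norm_num) z).hasFDerivAt.hasFDerivWithinAt)
    (fun z hz => (hC.norm_sub_le z x).trans
      (mul_le_mul_of_nonneg_left (by simpa [dist_eq_norm] using hz) C.2))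
    (Metric.mem_closedBall_self (norm_nonneg y)) hxy
  simpa [pow_two, mul_assoc] using this

section gaussian

variable {d : ℕ} {δ : ℝ}

lemma gaussDensity_eq (x : Ed d) : gaussDensity d δ x =
    (2 * Real.pi * δ) ^ (-(d : ℝ) / 2) * Real.exp (-(1 / (2 * δ)) * ‖x‖ ^ 2) := by
  rw [gaussDensity]
  congr 2
  ring

lemma integrable_exp_neg_mul_sq_norm {b : ℝ} (hb : 0 < b) :
    Integrable (fun x : Ed d => Real.exp (-b * ‖x‖ ^ 2)) := by
  refine .of_integral_ne_zero ?_
  rw [GaussianFourier.integral_rexp_neg_mul_sq_norm hb]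
  positivity

@[fun_prop]
lemma measurable_gaussDensity : Measurable (gaussDensity d δ) := by
  unfold gaussDensity
  fun_prop

lemma gaussDensity_nonneg (hδ : 0 < δ) (x : Ed d) : 0 ≤ gaussDensity d δ x := by
  unfold gaussDensity
  positivity

lemma isProbabilityMeasure_gaussMeasure (hδ : 0 < δ) :
    IsProbabilityMeasure (gaussMeasure d δ) := by
  refine ⟨?_⟩
  have hb : 0 < 1 / (2 * δ) := by positivity
  have hi : Integrable (gaussDensity d δ) := by
    rw [funext gaussDensity_eq]
    exact (integrable_exp_neg_mul_sq_norm hb).const_mul _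
  rw [gaussMeasure, withDensity_apply _ .univ, setLIntegral_univ,
    ← ofReal_integral_eq_lintegral_ofReal hi (.of_forall (gaussDensity_nonneg hδ))]
  simp_rw [gaussDensity_eq]
  rw [integral_const_mul, GaussianFourier.integral_rexp_neg_mul_sq_norm hb, finrank_euclideanSpace,
    Fintype.card_fin, show Real.pi / (1 / (2 * δ)) = 2 * Real.pi * δ by field_simp,
    ← Real.rpow_add (by positivity)]
  simp [neg_div]

/-- A dimensional constant bounding the second moment of the standard Gaussian. -/
def gaussMomentConst (d : ℕ) : ℝ := 4 * 2 ^ ((d : ℝ) / 2)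

lemma gaussMomentConst_nonneg : 0 ≤ gaussMomentConst d := by
  unfold gaussMomentConst
  positivity

lemma lintegral_sq_norm_gaussMeasure_le (hδ : 0 < δ) :
    ∫⁻ x, ENNReal.ofReal (‖x‖ ^ 2) ∂(gaussMeasure d δ) ≤
      ENNReal.ofReal (gaussMomentConst d * δ) := by
  have hb : 0 < 1 / (4 * δ) := by positivity
  set A : ℝ := (2 * Real.pi * δ) ^ (-(d : ℝ) / 2) with hA
  have hA0 : 0 ≤ A := by positivity
  have hp : ∀ x : Ed d, gaussDensity d δ x * ‖x‖ ^ 2 ≤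
      A * (4 * δ) * Real.exp (-(1 / (4 * δ)) * ‖x‖ ^ 2) := fun x => by
    rw [gaussDensity_eq, show -(1 / (2 * δ)) * ‖x‖ ^ 2 =
      -(1 / (4 * δ)) * ‖x‖ ^ 2 + -(1 / (4 * δ)) * ‖x‖ ^ 2 by field_simp; ring, Real.exp_add]
    have h1 : ‖x‖ ^ 2 * Real.exp (-(1 / (4 * δ)) * ‖x‖ ^ 2) ≤ 4 * δ := by
      rw [neg_mul, Real.exp_neg, ← div_eq_mul_inv, div_le_iff₀ (Real.exp_pos _)]
      have := Real.add_one_le_exp (1 / (4 * δ) * ‖x‖ ^ 2)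
      calc ‖x‖ ^ 2 = 4 * δ * (1 / (4 * δ) * ‖x‖ ^ 2) := by field_simp
        _ ≤ _ := by gcongr; linarith
    calc _ = A * (‖x‖ ^ 2 * Real.exp (-(1 / (4 * δ)) * ‖x‖ ^ 2)) *
          Real.exp (-(1 / (4 * δ)) * ‖x‖ ^ 2) := by ring
      _ ≤ _ := by gcongr
  rw [gaussMeasure, lintegral_withDensity_eq_lintegral_mul _ (by fun_prop) (by fun_prop)]
  calc _ ≤ ∫⁻ x : Ed d, ENNReal.ofReal (A * (4 * δ) * Real.exp (-(1 / (4 * δ)) * ‖x‖ ^ 2)) := by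
        refine lintegral_mono fun x => ?_
        rw [Pi.mul_apply, ← ENNReal.ofReal_mul (gaussDensity_nonneg hδ x)]
        exact ENNReal.ofReal_le_ofReal (hp x)
    _ = ENNReal.ofReal (gaussMomentConst d * δ) := by
        rw [← ofReal_integral_eq_lintegral_ofReal
          ((integrable_exp_neg_mul_sq_norm hb).const_mul _) (.of_forall fun x => by positivity),
          integral_const_mul, GaussianFourier.integral_rexp_neg_mul_sq_norm hb,
          finrank_euclideanSpace, Fintype.card_fin,
          show Real.pi / (1 / (4 * δ)) = 2 * (2 * Real.pi * δ) by field_simp; ring,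
          Real.mul_rpow (by positivity) (by positivity), gaussMomentConst, hA]
        congr 1
        have : (2 * Real.pi * δ) ^ (-(d : ℝ) / 2) * (2 * Real.pi * δ) ^ ((d : ℝ) / 2) = 1 := by
          rw [← Real.rpow_add (by positivity)]
          simp [neg_div]
        linear_combination (4 * δ * 2 ^ ((d : ℝ) / 2)) * this

lemma integrable_sq_norm_gaussMeasure (hδ : 0 < δ) :
    Integrable (fun x => ‖x‖ ^ 2) (gaussMeasure d δ) := by
  refine ⟨by fun_prop, ?_⟩
  rw [hasFiniteIntegral_iff_ofReal (.of_forall fun x => by positivity)]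
  exact (lintegral_sq_norm_gaussMeasure_le hδ).trans_lt ENNReal.ofReal_lt_top

lemma integral_sq_norm_gaussMeasure_le (hδ : 0 < δ) :
    ∫ x, ‖x‖ ^ 2 ∂(gaussMeasure d δ) ≤ gaussMomentConst d * δ := by
  rw [integral_eq_lintegral_of_nonneg_ae (.of_forall fun x => by positivity) (by fun_prop)]
  exact ENNReal.toReal_le_of_le_ofReal (mul_nonneg gaussMomentConst_nonneg hδ.le)
    (lintegral_sq_norm_gaussMeasure_le hδ)

lemma integral_clm_gaussMeasure (L : Ed d →L[ℝ] ℝ) : ∫ x, L x ∂(gaussMeasure d δ) = 0 := by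
  rw [gaussMeasure, integral_withDensity_eq_integral_toReal_smul (by fun_prop)
    (.of_forall fun x => ENNReal.ofReal_lt_top)]
  have h := integral_neg_eq_self
    (fun x : Ed d => (ENNReal.ofReal (gaussDensity d δ x)).toReal • L x) volume
  have h2 : ∀ x : Ed d, gaussDensity d δ (-x) = gaussDensity d δ x := fun x => by
    simp [gaussDensity]
  simp only [h2, map_neg, smul_neg, integral_neg] at h
  linarith

lemma integrable_clm_gaussMeasure (hδ : 0 < δ) (L : Ed d →L[ℝ] ℝ) :
    Integrable L (gaussMeasure d δ) := by
  have := isProbabilityMeasure_gaussMeasure (d := d) hδ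
  refine Integrable.mono' (((integrable_const (1 : ℝ)).add
    (integrable_sq_norm_gaussMeasure hδ)).const_mul ‖L‖) (by fun_prop) (.of_forall fun x => ?_)
  refine (L.le_opNorm x).trans (mul_le_mul_of_nonneg_left ?_ (norm_nonneg L))
  simp only [Pi.add_apply]
  nlinarith [sq_nonneg (‖x‖ - 1)]

/-- The heat semigroup acting on functions. -/
def heatSemigroup (d : ℕ) (δ : ℝ) (φ : Ed d → ℝ) (x : Ed d) : ℝ :=
  ∫ y, φ (x + y) ∂(gaussMeasure d δ)

lemma abs_heatSemigroup_sub_le (hδ : 0 < δ) {χ : Ed d → ℝ} (hχ : Continuous χ)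
    (hb : ∀ x, |χ x| ≤ 1) {c : ℝ} (hc0 : 0 ≤ c)
    (hc : ∀ x y, |χ (x + y) - χ x - fderiv ℝ χ x y| ≤ c * ‖y‖ ^ 2) (x : Ed d) :
    |heatSemigroup d δ χ x - χ x| ≤ c * gaussMomentConst d * δ := by
  have := isProbabilityMeasure_gaussMeasure (d := d) hδ
  have hi : Integrable (fun y => χ (x + y)) (gaussMeasure d δ) :=
    .of_bound (by fun_prop) 1 (.of_forall fun y => hb _)
  have hL := integrable_clm_gaussMeasure hδ (fderiv ℝ χ x)
  have e : heatSemigroup d δ χ x - χ x =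
      ∫ y, (χ (x + y) - χ x - fderiv ℝ χ x y) ∂(gaussMeasure d δ) := by
    have hi' : Integrable (fun y => χ (x + y) - χ x) (gaussMeasure d δ) :=
      hi.sub (integrable_const _)
    rw [integral_sub hi' hL, integral_sub hi (integrable_const _),
      integral_clm_gaussMeasure]
    simp [heatSemigroup]
  rw [e]
  calc |∫ y, (χ (x + y) - χ x - fderiv ℝ χ x y) ∂(gaussMeasure d δ)|
        ≤ ∫ y, c * ‖y‖ ^ 2 ∂(gaussMeasure d δ) :=
        norm_integral_le_of_norm_le
          (f := fun y => χ (x + y) - χ x - fderiv ℝ χ x y)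
          ((integrable_sq_norm_gaussMeasure hδ).const_mul c) (.of_forall fun y => hc x y)
    _ ≤ _ := by
        rw [integral_const_mul, mul_assoc]
        exact mul_le_mul_of_nonneg_left (integral_sq_norm_gaussMeasure_le hδ) hc0

lemma continuous_heatSemigroup (hδ : 0 < δ) {φ : Ed d → ℝ} (hφ : Continuous φ) {C : ℝ}
    (hb : ∀ x, |φ x| ≤ C) : Continuous (heatSemigroup d δ φ) := by
  have := isProbabilityMeasure_gaussMeasure (d := d) hδ
  exact continuous_of_dominated (fun x => by fun_prop) (fun x => .of_forall fun y => hb _)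
    (integrable_const C) (.of_forall fun y => by fun_prop)

lemma abs_heatSemigroup_le (hδ : 0 < δ) {φ : Ed d → ℝ} {C : ℝ} (hb : ∀ x, |φ x| ≤ C)
    (x : Ed d) : |heatSemigroup d δ φ x| ≤ C := by
  have := isProbabilityMeasure_gaussMeasure (d := d) hδ
  simpa [heatSemigroup] using norm_integral_le_of_norm_le (μ := gaussMeasure d δ)
    (f := fun y => φ (x + y)) (integrable_const C) (.of_forall fun y => hb (x + y))

variable {t s : ℝ} (hts : t < s)
include hts

lemma integral_heatFlow {μ : Measure (Ed d)} [IsProbabilityMeasure μ] {φ : Ed d → ℝ}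
    (hφ : Continuous φ) {C : ℝ} (hb : ∀ x, |φ x| ≤ C) :
    ∫ x, φ x ∂(heatFlow d t s μ) = ∫ x, heatSemigroup d (s - t) φ x ∂μ := by
  have := isProbabilityMeasure_gaussMeasure (d := d) (sub_pos.2 hts)
  rw [heatFlow, if_neg hts.not_ge, integral_map (by fun_prop) (by fun_prop), integral_prod]
  · rfl
  · exact .of_bound (by fun_prop) C (.of_forall fun y => hb _)

lemma isProbabilityMeasure_heatFlow (μ : Measure (Ed d)) [IsProbabilityMeasure μ] :
    IsProbabilityMeasure (heatFlow d t s μ) := by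
  have := isProbabilityMeasure_gaussMeasure (d := d) (sub_pos.2 hts)
  rw [heatFlow, if_neg hts.not_ge]
  exact Measure.isProbabilityMeasure_map (by fun_prop)

lemma integrable_integral_sq_norm_heatFlow {μ : Measure (Ed d)} [IsProbabilityMeasure μ]
    (hμ : Integrable (fun x => ‖x‖ ^ 2) μ) :
    Integrable (fun x => ‖x‖ ^ 2) (heatFlow d t s μ) ∧
      ∫ x, ‖x‖ ^ 2 ∂(heatFlow d t s μ) ≤
        2 * ∫ x, ‖x‖ ^ 2 ∂μ + 2 * gaussMomentConst d * (s - t) := by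
  have hδ := sub_pos.2 hts
  have := isProbabilityMeasure_gaussMeasure (d := d) hδ
  have h1 : Integrable (fun q : Ed d × Ed d => 2 * ‖q.1‖ ^ 2) (μ.prod (gaussMeasure d (s - t))) :=
    (hμ.comp_fst _).const_mul 2
  have h2 : Integrable (fun q : Ed d × Ed d => 2 * ‖q.2‖ ^ 2) (μ.prod (gaussMeasure d (s - t))) :=
    ((integrable_sq_norm_gaussMeasure hδ).comp_snd _).const_mul 2
  have hle : ∀ q : Ed d × Ed d, ‖q.1 + q.2‖ ^ 2 ≤ 2 * ‖q.1‖ ^ 2 + 2 * ‖q.2‖ ^ 2 := fun q => by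
    have := norm_add_le q.1 q.2
    nlinarith [sq_nonneg (‖q.1‖ - ‖q.2‖), norm_nonneg (q.1 + q.2)]
  have h3 : Integrable (fun q : Ed d × Ed d => ‖q.1 + q.2‖ ^ 2)
      (μ.prod (gaussMeasure d (s - t))) := by
    refine (h1.add h2).mono' (by fun_prop) (.of_forall fun q => ?_)
    rw [Real.norm_of_nonneg (by positivity)]
    exact hle q
  rw [heatFlow, if_neg hts.not_ge]
  refine ⟨(integrable_map_measure (by fun_prop) (by fun_prop)).2 h3, ?_⟩
  rw [integral_map (by fun_prop) (by fun_prop)]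
  calc _ ≤ ∫ q, (2 * ‖q.1‖ ^ 2 + 2 * ‖q.2‖ ^ 2) ∂(μ.prod (gaussMeasure d (s - t))) :=
        integral_mono h3 (h1.add h2) hle
    _ = 2 * ∫ x, ‖x‖ ^ 2 ∂μ + 2 * ∫ x, ‖x‖ ^ 2 ∂(gaussMeasure d (s - t)) := by
        rw [integral_add h1 h2, integral_const_mul, integral_const_mul,
          integral_fun_fst (fun x : Ed d => ‖x‖ ^ 2), integral_fun_snd (fun x : Ed d => ‖x‖ ^ 2)]
        simp
    _ ≤ _ := by linarith [integral_sq_norm_gaussMeasure_le (d := d) hδ]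

end gaussian

attribute [instance] MVP.mΩ MVP.probP

open ProbabilityTheory

lemma integral_comp_measure {α β : Type*} [MeasurableSpace α] [MeasurableSpace β]
    {μ : Measure α} [SFinite μ] {κ : Kernel α β} [IsSFiniteKernel κ] {f : β → ℝ}
    (hf : Integrable f (κ ∘ₘ μ)) : ∫ y, f y ∂(κ ∘ₘ μ) = ∫ x, ∫ y, f y ∂(κ x) ∂μ := by
  rw [Measure.comp_eq_comp_const_apply] at hf ⊢
  simpa using Kernel.integral_comp hf

/-- The mean square distance to the conditional expectation. -/
lemma integral_sq_sub_condExp {Ω : Type*} {m m₀ : MeasurableSpace Ω} (hm : m ≤ m₀)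
    {P : Measure Ω} [IsProbabilityMeasure P] {Y Z : Ω → ℝ} (hY : MemLp Y 2 P)
    (hZ : P[Y | m] =ᵐ[P] Z) :
    ∫ ω, (Y ω - Z ω) ^ 2 ∂P = ∫ ω, Y ω ^ 2 ∂P - ∫ ω, Z ω ^ 2 ∂P := by
  have h1 : ∫ ω, (Y ω - Z ω) ^ 2 ∂P = ∫ ω, Var[Y; P | m] ω ∂P := by
    rw [condVar, integral_condExp hm]
    refine integral_congr_ae ?_
    filter_upwards [hZ] with ω hω
    simp [hω]
  have h2 : ∫ ω, Z ω ^ 2 ∂P = ∫ ω, (P[Y | m] ^ 2) ω ∂P := by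
    refine integral_congr_ae ?_
    filter_upwards [hZ] with ω hω
    simp [hω]
  have hi : Integrable (P[Y | m] ^ 2) P := (hY.condExp one_le_two).integrable_sq
  rw [h1, h2, integral_congr_ae (condVar_ae_eq_condExp_sq_sub_sq_condExp hm hY),
    integral_sub' integrable_condExp hi, integral_condExp hm]
  rfl

lemma genFiltration_le {Ω : Type} [mΩ : MeasurableSpace Ω] {d : ℕ} {M : ℝ → Ω → Measure (Ed d)}
    (hM : ∀ s, Measurable (M s)) (t s : ℝ) : genFiltration d M t s ≤ mΩ :=
  (iInf₂_le (s + 1) (by simp)).trans (iSup₂_le fun r _ => (hM r).comap_le)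

namespace MVP

variable {d : ℕ} {T t : ℝ} {m : Measure (Ed d)} (X : MVP d T t m) {s : ℝ}

/-- The process at time `s`, as a kernel. -/
def kernel (s : ℝ) : Kernel X.Ω (Ed d) := ⟨X.M s, X.meas s⟩

lemma kernel_apply (ω : X.Ω) : X.kernel s ω = X.M s ω := rfl

lemma isProbabilityMeasure (hs : s ∈ Icc t T) (ω : X.Ω) : IsProbabilityMeasure (X.M s ω) :=
  (X.inP1 s hs ω).1

lemma isMarkovKernel (hs : s ∈ Icc t T) : IsMarkovKernel (X.kernel s) :=
  ⟨X.isProbabilityMeasure hs⟩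

lemma stronglyMeasurable_integral (hs : s ∈ Icc t T) {φ : Ed d → ℝ} (hφ : Continuous φ) :
    StronglyMeasurable (fun ω => ∫ x, φ x ∂(X.M s ω)) := by
  have := X.isMarkovKernel hs
  exact StronglyMeasurable.integral_kernel (κ := X.kernel s) hφ.stronglyMeasurable

lemma abs_integral_le (hs : s ∈ Icc t T) {φ : Ed d → ℝ} {C : ℝ} (hb : ∀ x, |φ x| ≤ C) (ω : X.Ω) :
    |∫ x, φ x ∂(X.M s ω)| ≤ C := by
  have := X.isProbabilityMeasure hs ω
  simpa using norm_integral_le_of_norm_le (μ := X.M s ω) (f := φ) (integrable_const C)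
    (.of_forall fun x => hb x)

lemma integral_integral_start {φ : Ed d → ℝ} (hφ : Continuous φ) {C : ℝ} (hb : ∀ x, |φ x| ≤ C) :
    ∫ ω, ∫ x, φ x ∂(X.M t ω) ∂X.P = ∫ x, φ x ∂m :=
  X.init (.ofNormedAddCommGroup φ hφ C hb)

lemma condExp_integral {s₁ s₂ : ℝ} (h1 : t ≤ s₁) (h12 : s₁ < s₂) (h2 : s₂ ≤ T) {φ : Ed d → ℝ}
    (hφ : Continuous φ) {C : ℝ} (hb : ∀ x, |φ x| ≤ C) :
    X.P[(fun ω => ∫ x, φ x ∂(X.M s₂ ω)) | genFiltration d X.M t s₁]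
      =ᵐ[X.P] fun ω => ∫ x, heatSemigroup d (s₂ - s₁) φ x ∂(X.M s₁ ω) := by
  refine (X.cond s₁ s₂ h1 h12.le h2 (.ofNormedAddCommGroup φ hφ C hb)).trans
    (.of_forall fun ω => ?_)
  have := X.isProbabilityMeasure ⟨h1, h12.le.trans h2⟩ ω
  exact integral_heatFlow h12 hφ hb

/-- The averaged process follows the heat flow. -/
lemma comp_kernel_eq [IsProbabilityMeasure m] (hs : s ∈ Icc t T) :
    X.kernel s ∘ₘ X.P = heatFlow d t s m := by
  have := X.isMarkovKernel hs
  have hm : IsFiniteMeasure (heatFlow d t s m) := by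
    rcases hs.1.eq_or_lt with rfl | hlt
    · simp only [heatFlow, le_refl, if_true]; infer_instance
    · have := isProbabilityMeasure_heatFlow hlt m
      infer_instance
  refine ext_of_forall_integral_eq_of_IsFiniteMeasure fun φ => ?_
  rw [integral_comp_measure (φ.integrable _)]
  simp_rw [kernel_apply]
  have hb : ∀ x, |φ x| ≤ ‖φ‖ := φ.norm_coe_le_norm
  rcases hs.1.eq_or_lt with rfl | hlt
  · rw [X.init φ]
    simp [heatFlow]
  · have hδ := sub_pos.2 hlt
    rw [integral_heatFlow hlt φ.continuous hb,
      ← X.integral_integral_start (continuous_heatSemigroup hδ φ.continuous hb)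
        (abs_heatSemigroup_le hδ hb),
      ← integral_condExp (genFiltration_le X.meas t t),
      integral_congr_ae (X.condExp_integral le_rfl hlt hs.2 φ.continuous hb)]

section moment

variable (hm : MemP d 2 m) (hs : s ∈ Icc t T)
include hm hs

lemma integrable_sq_norm_heatFlow_start :
    Integrable (fun x => ‖x‖ ^ 2) (heatFlow d t s m) ∧
      ∫ x, ‖x‖ ^ 2 ∂(heatFlow d t s m) ≤
        2 * ∫ x, ‖x‖ ^ 2 ∂m + 2 * gaussMomentConst d * (T - t) := by
  have := hm.1
  have h2 : Integrable (fun x => ‖x‖ ^ 2) m := by simpa using hm.2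
  have hC := gaussMomentConst_nonneg (d := d)
  rcases hs.1.eq_or_lt with rfl | hlt
  · simp only [heatFlow, le_refl, if_true]
    have : 0 ≤ ∫ x, ‖x‖ ^ 2 ∂m := integral_nonneg fun x => by positivity
    have : 0 ≤ 2 * gaussMomentConst d * (T - t) :=
      mul_nonneg (by positivity) (sub_nonneg.2 hs.2)
    exact ⟨h2, by linarith⟩
  · obtain ⟨h3, h4⟩ := integrable_integral_sq_norm_heatFlow hlt h2
    refine ⟨h3, h4.trans ?_⟩
    gcongr
    exact hs.2

lemma ae_integrable_sq_norm : ∀ᵐ ω ∂X.P, Integrable (fun x => ‖x‖ ^ 2) (X.M s ω) := by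
  have := hm.1
  have := X.isMarkovKernel hs
  have h := (integrable_sq_norm_heatFlow_start hm hs).1
  rw [← X.comp_kernel_eq hs] at h
  exact Measure.ae_integrable_of_integrable_comp h

lemma integrable_integral_sq_norm : Integrable (fun ω => ∫ x, ‖x‖ ^ 2 ∂(X.M s ω)) X.P := by
  have := hm.1
  have := X.isMarkovKernel hs
  have h := (integrable_sq_norm_heatFlow_start hm hs).1
  rw [← X.comp_kernel_eq hs] at h
  simpa [kernel_apply] using Measure.integrable_integral_norm_of_integrable_comp h

lemma integral_integral_sq_norm_le : ∫ ω, ∫ x, ‖x‖ ^ 2 ∂(X.M s ω) ∂X.P ≤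
    2 * ∫ x, ‖x‖ ^ 2 ∂m + 2 * gaussMomentConst d * (T - t) := by
  have := hm.1
  have := X.isMarkovKernel hs
  obtain ⟨h, h'⟩ := integrable_sq_norm_heatFlow_start hm hs
  rw [← X.comp_kernel_eq hs] at h h'
  rwa [integral_comp_measure h] at h'

end moment

/-- The increment of the process between `s₁` and `s₂`, tested against `φ`. -/
def increment (φ : Ed d → ℝ) (s₁ s₂ : ℝ) (ω : X.Ω) : ℝ :=
  ∫ x, φ x ∂(X.M s₂ ω) - ∫ x, φ x ∂(heatFlow d s₁ s₂ (X.M s₁ ω))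

section increment

variable {s₁ s₂ : ℝ} (h1 : t ≤ s₁) (h12 : s₁ < s₂) (h2 : s₂ ≤ T) {φ : Ed d → ℝ}
  (hφ : Continuous φ) (hb : ∀ x, |φ x| ≤ 1)
include h1 h12 h2 hφ hb

lemma increment_eq (ω : X.Ω) : X.increment φ s₁ s₂ ω =
    ∫ x, φ x ∂(X.M s₂ ω) - ∫ x, heatSemigroup d (s₂ - s₁) φ x ∂(X.M s₁ ω) := by
  have := X.isProbabilityMeasure ⟨h1, h12.le.trans h2⟩ ω
  rw [increment, integral_heatFlow h12 hφ hb]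

lemma stronglyMeasurable_increment : StronglyMeasurable (X.increment φ s₁ s₂) := by
  rw [funext (X.increment_eq h1 h12 h2 hφ hb)]
  exact (X.stronglyMeasurable_integral ⟨h1.trans h12.le, h2⟩ hφ).sub
    (X.stronglyMeasurable_integral ⟨h1, h12.le.trans h2⟩
      (continuous_heatSemigroup (sub_pos.2 h12) hφ hb))

lemma abs_increment_le (ω : X.Ω) : |X.increment φ s₁ s₂ ω| ≤ 2 := by
  rw [X.increment_eq h1 h12 h2 hφ hb]
  refine (abs_sub _ _).trans ?_
  linarith [X.abs_integral_le ⟨h1.trans h12.le, h2⟩ hb ω,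
    X.abs_integral_le ⟨h1, h12.le.trans h2⟩ (abs_heatSemigroup_le (sub_pos.2 h12) hb) ω]

lemma integrable_increment_sq : Integrable (fun ω => X.increment φ s₁ s₂ ω ^ 2) X.P := by
  refine .of_bound ((X.stronglyMeasurable_increment h1 h12 h2 hφ hb).pow 2).aestronglyMeasurable
    (2 ^ 2) (.of_forall fun ω => ?_)
  rw [norm_pow]
  exact pow_le_pow_left₀ (norm_nonneg _) (X.abs_increment_le h1 h12 h2 hφ hb ω) 2

lemma integral_increment_sq_le {C : ℝ}
    (hC : ∀ x, |heatSemigroup d (s₂ - s₁) φ x - φ x| ≤ C * (s₂ - s₁)) :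
    ∫ ω, X.increment φ s₁ s₂ ω ^ 2 ∂X.P ≤ ∫ ω, (∫ x, φ x ∂(X.M s₂ ω)) ^ 2 ∂X.P -
      ∫ ω, (∫ x, φ x ∂(X.M s₁ ω)) ^ 2 ∂X.P + 2 * C * (s₂ - s₁) := by
  have hδ := sub_pos.2 h12
  have hs1 : s₁ ∈ Icc t T := ⟨h1, h12.le.trans h2⟩
  have hs2 : s₂ ∈ Icc t T := ⟨h1.trans h12.le, h2⟩
  have hPφ := continuous_heatSemigroup hδ hφ hb
  have hPb := abs_heatSemigroup_le hδ hb
  have hlp : ∀ {r : ℝ} (hr : r ∈ Icc t T) {ψ : Ed d → ℝ} (_ : Continuous ψ) (_ : ∀ x, |ψ x| ≤ 1),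
      MemLp (fun ω => ∫ x, ψ x ∂(X.M r ω)) 2 X.P := fun hr ψ hψ hψb =>
    .of_bound (X.stronglyMeasurable_integral hr hψ).aestronglyMeasurable 1
      (.of_forall (X.abs_integral_le hr hψb))
  simp_rw [X.increment_eq h1 h12 h2 hφ hb]
  rw [integral_sq_sub_condExp (genFiltration_le X.meas t s₁) (hlp hs2 hφ hb)
    (X.condExp_integral h1 h12 h2 hφ hb)]
  have hle : ∀ ω, (∫ x, φ x ∂(X.M s₁ ω)) ^ 2 ≤
      (∫ x, heatSemigroup d (s₂ - s₁) φ x ∂(X.M s₁ ω)) ^ 2 + 2 * C * (s₂ - s₁) := fun ω => by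
    have := X.isProbabilityMeasure hs1 ω
    have hd : |∫ x, heatSemigroup d (s₂ - s₁) φ x ∂(X.M s₁ ω) - ∫ x, φ x ∂(X.M s₁ ω)|
        ≤ C * (s₂ - s₁) := by
      rw [← integral_sub (.of_bound hPφ.aestronglyMeasurable 1 (.of_forall hPb))
        (.of_bound hφ.aestronglyMeasurable 1 (.of_forall hb))]
      simpa using norm_integral_le_of_norm_le (μ := X.M s₁ ω)
        (f := fun x => heatSemigroup d (s₂ - s₁) φ x - φ x)
        (integrable_const (C * (s₂ - s₁))) (.of_forall hC)
    have ha := abs_le.1 (X.abs_integral_le hs1 hb ω)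
    have hb' := abs_le.1 (X.abs_integral_le hs1 hPb ω)
    rw [abs_le] at hd
    nlinarith
  have := integral_mono (hlp hs1 hφ hb).integrable_sq
    ((hlp hs1 hPφ hPb).integrable_sq.add (integrable_const _)) hle
  simp only [Pi.add_apply] at this
  rw [integral_add (hlp hs1 hPφ hPb).integrable_sq (integrable_const _)] at this
  simp at this
  linarith

end increment

end MVP

/-- The distance `d₁` is controlled by finitely many smooth test functions and second moments. -/
lemma exists_wdist_one_le (d : ℕ) {ε : ℝ} (hε : 0 < ε) :
    ∃ (ι : Type) (_ : Fintype ι) (χ : ι → Ed d → ℝ) (K C : ℝ), 0 ≤ K ∧ 0 ≤ C ∧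
      (∀ i, Continuous (χ i)) ∧ (∀ i x, |χ i x| ≤ 1) ∧
      (∀ i δ, 0 < δ → ∀ x, |heatSemigroup d δ (χ i) x - χ i x| ≤ C * δ) ∧
      ∀ μ ν : Measure (Ed d), IsProbabilityMeasure μ → IsProbabilityMeasure ν →
        Integrable (fun x => ‖x‖ ^ 2) μ → Integrable (fun x => ‖x‖ ^ 2) ν →
        wdist d 1 μ ν ≤ ε + K * ∑ i, |∫ x, χ i x ∂μ - ∫ x, χ i x ∂ν| +
          ε * (∫ x, ‖x‖ ^ 2 ∂μ + ∫ x, ‖x‖ ^ 2 ∂ν) := by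
  obtain ⟨ι, hι, χ, hχ, hc, h0, h1, hsum, hdiam⟩ := exists_smooth_partition d ε⁻¹ hε
  obtain ⟨K, hK0, hK⟩ := exists_norm_le_of_hasCompactSupport hc
  choose c hc0 hcb using fun i => exists_taylor_bound (hχ i) (hc i)
  have hG := gaussMomentConst_nonneg (d := d)
  have hb : ∀ i x, |χ i x| ≤ 1 := fun i x => by
    rw [abs_of_nonneg (h0 i x)]
    exact (Finset.single_le_sum (fun j _ => h0 j x) (Finset.mem_univ i)).trans (h1 x)
  refine ⟨ι, hι, χ, K, (∑ i, c i) * gaussMomentConst d, hK0,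
    mul_nonneg (Finset.sum_nonneg fun i _ => hc0 i) hG, fun i => (hχ i).continuous, hb,
    fun i δ hδ x => ?_, fun μ ν _ _ hμ hν => ?_⟩
  · refine (abs_heatSemigroup_sub_le hδ (hχ i).continuous (hb i) (hc0 i) (hcb i) x).trans ?_
    gcongr
    exact Finset.single_le_sum (fun j _ => hc0 j) (Finset.mem_univ i)
  · simpa using wdist_one_le (fun i => (hχ i).continuous.measurable) h0 h1 (inv_pos.2 hε) hε.le
      hsum hK hK0 hdiam hμ hν

lemma abs_le_add_inv_mul_sq {α : ℝ} (hα : 0 < α) (x : ℝ) : |x| ≤ α + α⁻¹ * x ^ 2 := by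
  have h : α + α⁻¹ * x ^ 2 - |x| = α⁻¹ * ((|x| - α / 2) ^ 2 + 3 / 4 * α ^ 2) := by
    rw [← sq_abs x]
    field_simp
    ring
  have : 0 ≤ α⁻¹ * ((|x| - α / 2) ^ 2 + 3 / 4 * α ^ 2) := by positivity
  linarith

lemma integral_sum_mul_le {Ω : Type*} [MeasurableSpace Ω] {P : Measure Ω} {n : ℕ} {w b : ℕ → ℝ}
    {f : ℕ → Ω → ℝ} (hw : ∀ q < n, 0 ≤ w q) (hf : ∀ q ω, 0 ≤ f q ω)
    (h : ∀ q < n, ∃ G : Ω → ℝ, Integrable G P ∧ (∀ᵐ ω ∂P, f q ω ≤ G ω) ∧ ∫ ω, G ω ∂P ≤ b q) :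
    ∫ ω, ∑ q ∈ Finset.range n, w q * f q ω ∂P ≤ ∑ q ∈ Finset.range n, w q * b q := by
  choose! G hG hfG hGb using h
  have hi : ∀ q ∈ Finset.range n, Integrable (fun ω => w q * G q ω) P := fun q hq =>
    (hG q (Finset.mem_range.1 hq)).const_mul _
  calc ∫ ω, ∑ q ∈ Finset.range n, w q * f q ω ∂P
      ≤ ∫ ω, ∑ q ∈ Finset.range n, w q * G q ω ∂P := by
        refine integral_mono_of_nonneg (.of_forall fun ω => Finset.sum_nonneg fun q hq =>
          mul_nonneg (hw q (Finset.mem_range.1 hq)) (hf q ω)) (integrable_finsetSum _ hi) ?_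
        have := (ae_ball_iff (Finset.range n).countable_toSet).2
          fun q hq => hfG q (Finset.mem_range.1 hq)
        filter_upwards [this] with ω hω
        exact Finset.sum_le_sum fun q hq =>
          mul_le_mul_of_nonneg_left (hω q hq) (hw q (Finset.mem_range.1 hq))
    _ = ∑ q ∈ Finset.range n, w q * ∫ ω, G q ω ∂P := by
        rw [integral_finsetSum _ hi]
        simp_rw [integral_const_mul]
    _ ≤ ∑ q ∈ Finset.range n, w q * b q := Finset.sum_le_sum fun q hq =>
        mul_le_mul_of_nonneg_left (hGb q (Finset.mem_range.1 hq)) (hw q (Finset.mem_range.1 hq))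

namespace MVP

variable {d : ℕ} {T t : ℝ} {m : Measure (Ed d)} (X : MVP d T t m)

/-- The quadratic variation of the process tested against `φ` is bounded. -/
lemma sum_integral_increment_sq_le {n : ℕ} {τ : ℕ → ℝ} (hmem : ∀ q ≤ n, τ q ∈ Icc t T)
    (hlt : ∀ q < n, τ q < τ (q + 1)) {φ : Ed d → ℝ} (hφ : Continuous φ) (hb : ∀ x, |φ x| ≤ 1)
    {C : ℝ} (hC0 : 0 ≤ C)
    (hC : ∀ δ, 0 < δ → ∀ x, |heatSemigroup d δ φ x - φ x| ≤ C * δ) :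
    ∑ q ∈ Finset.range n, ∫ ω, X.increment φ (τ q) (τ (q + 1)) ω ^ 2 ∂X.P ≤
      1 + 2 * C * (T - t) := by
  let E : ℝ → ℝ := fun s => ∫ ω, (∫ x, φ x ∂(X.M s ω)) ^ 2 ∂X.P
  have hE0 : 0 ≤ E (τ 0) := integral_nonneg fun ω => sq_nonneg _
  have hE1 : E (τ n) ≤ 1 := by
    have h : ∀ ω, ‖(∫ x, φ x ∂(X.M (τ n) ω)) ^ 2‖ ≤ 1 := fun ω => by
      rw [norm_pow]
      exact pow_le_one₀ (norm_nonneg _) (X.abs_integral_le (hmem n le_rfl) hb ω)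
    have := norm_integral_le_of_norm_le (μ := X.P) (integrable_const (1 : ℝ)) (.of_forall h)
    simp only [integral_const, probReal_univ, smul_eq_mul, mul_one] at this
    exact (le_abs_self _).trans this
  calc ∑ q ∈ Finset.range n, ∫ ω, X.increment φ (τ q) (τ (q + 1)) ω ^ 2 ∂X.P
      ≤ ∑ q ∈ Finset.range n,
          ((E (τ (q + 1)) - E (τ q)) + 2 * C * (τ (q + 1) - τ q)) := by
        refine Finset.sum_le_sum fun q hq => ?_
        have hq := Finset.mem_range.1 hq
        exact X.integral_increment_sq_le (hmem q hq.le).1 (hlt q hq) (hmem (q + 1) hq).2 hφ hb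
          (hC _ (sub_pos.2 (hlt q hq)))
    _ = (E (τ n) - E (τ 0)) + 2 * C * (τ n - τ 0) := by
        rw [Finset.sum_add_distrib, ← Finset.mul_sum, Finset.sum_range_sub (fun q => E (τ q)),
          Finset.sum_range_sub]
    _ ≤ 1 + 2 * C * (T - t) := by
        have : 2 * C * (τ n - τ 0) ≤ 2 * C * (T - t) := by
          gcongr
          exacts [(hmem n le_rfl).2, (hmem 0 n.zero_le).1]
        linarith

/-- A uniform bound for the second moment of the process. -/
def momentBound (d : ℕ) (T t : ℝ) (m : Measure (Ed d)) : ℝ :=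
  2 * ∫ x, ‖x‖ ^ 2 ∂m + 2 * gaussMomentConst d * (T - t)

section majorant

variable (hm : MemP d 2 m) {ι : Type} [Fintype ι] {χ : ι → Ed d → ℝ} {K ε : ℝ}
  (hK : 0 ≤ K) (hε : 0 ≤ ε) (hχ : ∀ i, Continuous (χ i)) (hb : ∀ i x, |χ i x| ≤ 1)
  (hdist : ∀ μ ν : Measure (Ed d), IsProbabilityMeasure μ → IsProbabilityMeasure ν →
    Integrable (fun x => ‖x‖ ^ 2) μ → Integrable (fun x => ‖x‖ ^ 2) ν →
    wdist d 1 μ ν ≤ ε + K * ∑ i, |∫ x, χ i x ∂μ - ∫ x, χ i x ∂ν| +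
      ε * (∫ x, ‖x‖ ^ 2 ∂μ + ∫ x, ‖x‖ ^ 2 ∂ν))
include hm hK hε hb hdist

lemma exists_majorant_start (htT : t ≤ T) :
    ∃ G : X.Ω → ℝ, Integrable G X.P ∧ (∀ᵐ ω ∂X.P, wdist d 1 (X.M t ω) m ≤ G ω) ∧
      ∫ ω, G ω ∂X.P ≤ ε + K * (Fintype.card ι * 2) +
        ε * (momentBound d T t m + ∫ x, ‖x‖ ^ 2 ∂m) := by
  have hs : t ∈ Icc t T := ⟨le_rfl, htT⟩
  have hmP := hm.1
  have h2 : Integrable (fun x => ‖x‖ ^ 2) m := by simpa using hm.2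
  have hi := X.integrable_integral_sq_norm hm hs
  have hi' : Integrable (fun ω => ∫ x, ‖x‖ ^ 2 ∂(X.M t ω) + ∫ x, ‖x‖ ^ 2 ∂m) X.P :=
    hi.add (integrable_const _)
  refine ⟨fun ω => ε + K * (Fintype.card ι * 2) +
    ε * (∫ x, ‖x‖ ^ 2 ∂(X.M t ω) + ∫ x, ‖x‖ ^ 2 ∂m),
    (integrable_const _).add (hi'.const_mul _), ?_, ?_⟩
  · filter_upwards [X.ae_integrable_sq_norm hm hs] with ω hω
    have hP := X.isProbabilityMeasure hs ω
    refine (hdist _ _ hP hmP hω h2).trans ?_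
    gcongr
    have : ∀ i ∈ Finset.univ, |∫ x, χ i x ∂(X.M t ω) - ∫ x, χ i x ∂m| ≤ 2 := fun i _ => by
      refine (abs_sub _ _).trans ?_
      have h := norm_integral_le_of_norm_le (μ := m) (f := χ i) (integrable_const (1 : ℝ))
        (.of_forall (hb i))
      simp only [integral_const, probReal_univ, smul_eq_mul, mul_one, Real.norm_eq_abs] at h
      linarith [X.abs_integral_le hs (hb i) ω]
    simpa using Finset.sum_le_sum this
  · rw [integral_add (integrable_const _) (hi'.const_mul _),
      integral_const_mul, integral_add hi (integrable_const _)]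
    simp only [integral_const, probReal_univ, smul_eq_mul, one_mul]
    gcongr
    exact X.integral_integral_sq_norm_le hm hs

include hχ

lemma exists_majorant {s₁ s₂ : ℝ} (h1 : t ≤ s₁) (h12 : s₁ < s₂) (h2 : s₂ ≤ T) {α : ℝ}
    (hα : 0 < α) :
    ∃ G : X.Ω → ℝ, Integrable G X.P ∧
      (∀ᵐ ω ∂X.P, wdist d 1 (X.M s₂ ω) (heatFlow d s₁ s₂ (X.M s₁ ω)) ≤ G ω) ∧
      ∫ ω, G ω ∂X.P ≤ ε + K * ∑ i, (α + α⁻¹ * ∫ ω, X.increment (χ i) s₁ s₂ ω ^ 2 ∂X.P) +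
        ε * (3 * momentBound d T t m + 2 * gaussMomentConst d * (T - t)) := by
  have hs1 : s₁ ∈ Icc t T := ⟨h1, h12.le.trans h2⟩
  have hs2 : s₂ ∈ Icc t T := ⟨h1.trans h12.le, h2⟩
  have hG := gaussMomentConst_nonneg (d := d)
  have hi1 := X.integrable_integral_sq_norm hm hs1
  have hi2 := X.integrable_integral_sq_norm hm hs2
  have hinc := fun i => X.integrable_increment_sq h1 h12 h2 (hχ i) (hb i)
  have hj : ∀ i ∈ Finset.univ, Integrable
      (fun ω => α + α⁻¹ * X.increment (χ i) s₁ s₂ ω ^ 2) X.P := fun i _ =>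
    (integrable_const _).add ((hinc i).const_mul _)
  have hj' : Integrable (fun ω => ε + K * ∑ i, (α + α⁻¹ * X.increment (χ i) s₁ s₂ ω ^ 2)) X.P :=
    (integrable_const _).add ((integrable_finsetSum _ hj).const_mul K)
  have hi3 : Integrable (fun ω => ∫ x, ‖x‖ ^ 2 ∂(X.M s₂ ω) + 2 * ∫ x, ‖x‖ ^ 2 ∂(X.M s₁ ω)) X.P :=
    hi2.add (hi1.const_mul 2)
  have hi4 : Integrable (fun ω => ε * (∫ x, ‖x‖ ^ 2 ∂(X.M s₂ ω) + 2 * ∫ x, ‖x‖ ^ 2 ∂(X.M s₁ ω) +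
      2 * gaussMomentConst d * (T - t))) X.P := (hi3.add (integrable_const _)).const_mul _
  refine ⟨fun ω => ε + K * ∑ i, (α + α⁻¹ * X.increment (χ i) s₁ s₂ ω ^ 2) +
    ε * (∫ x, ‖x‖ ^ 2 ∂(X.M s₂ ω) + 2 * ∫ x, ‖x‖ ^ 2 ∂(X.M s₁ ω) +
      2 * gaussMomentConst d * (T - t)), hj'.add hi4, ?_, ?_⟩
  · filter_upwards [X.ae_integrable_sq_norm hm hs1, X.ae_integrable_sq_norm hm hs2] with ω hω1 hω2
    have hP1 := X.isProbabilityMeasure hs1 ω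
    have hP2 := X.isProbabilityMeasure hs2 ω
    obtain ⟨h3, h4⟩ := integrable_integral_sq_norm_heatFlow h12 hω1
    refine (hdist _ _ hP2 (isProbabilityMeasure_heatFlow h12 _) hω2 h3).trans ?_
    have h5 : 2 * gaussMomentConst d * (s₂ - s₁) ≤ 2 * gaussMomentConst d * (T - t) := by
      gcongr
    have h6 : ∀ i, |∫ x, χ i x ∂(X.M s₂ ω) - ∫ x, χ i x ∂(heatFlow d s₁ s₂ (X.M s₁ ω))| ≤
        α + α⁻¹ * X.increment (χ i) s₁ s₂ ω ^ 2 := fun i => abs_le_add_inv_mul_sq hα _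
    gcongr ε + K * ∑ i, ?_ + ε * ?_ with i
    · exact h6 i
    · linarith
  · rw [integral_add hj' hi4,
      integral_add (integrable_const _) ((integrable_finsetSum _ hj).const_mul K),
      integral_const_mul, integral_const_mul, integral_finsetSum _ hj,
      integral_add hi3 (integrable_const _), integral_add hi2 (hi1.const_mul 2),
      integral_const_mul]
    simp only [integral_const, probReal_univ, smul_eq_mul, one_mul]
    gcongr with i
    · rw [integral_add (integrable_const _) ((hinc i).const_mul _), integral_const_mul]
      simp
    · have hB1 := X.integral_integral_sq_norm_le hm hs1
      have hB2 := X.integral_integral_sq_norm_le hm hs2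
      rw [← momentBound] at hB1 hB2
      linarith

end majorant

/-- Summing the one-step bounds against small weights. -/
lemma sum_mul_le {n : ℕ} {τ w : ℕ → ℝ} (hmem : ∀ q ≤ n, τ q ∈ Icc t T)
    (hlt : ∀ q < n, τ q < τ (q + 1)) {ι : Type} [Fintype ι] {χ : ι → Ed d → ℝ}
    (hχ : ∀ i, Continuous (χ i)) (hb : ∀ i x, |χ i x| ≤ 1) {C : ℝ} (hC0 : 0 ≤ C)
    (hC : ∀ i δ, 0 < δ → ∀ x, |heatSemigroup d δ (χ i) x - χ i x| ≤ C * δ)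
    {K α β η : ℝ} (hK : 0 ≤ K) (hα : 0 < α) (hβ : 0 ≤ β) (hη : 0 ≤ η)
    (hwη : ∀ q < n, w q ≤ η) (hw : ∑ q ∈ Finset.range n, w q ≤ T - t) :
    ∑ q ∈ Finset.range n, w q * (β + K * ∑ i,
        (α + α⁻¹ * ∫ ω, X.increment (χ i) (τ q) (τ (q + 1)) ω ^ 2 ∂X.P)) ≤
      (T - t) * β + α * (K * Fintype.card ι * (T - t)) +
        η * (K * α⁻¹ * Fintype.card ι * (1 + 2 * C * (T - t))) := by
  let e : ℕ → ι → ℝ := fun q i => ∫ ω, X.increment (χ i) (τ q) (τ (q + 1)) ω ^ 2 ∂X.P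
  have he : ∀ q i, 0 ≤ e q i := fun q i => integral_nonneg fun ω => sq_nonneg _
  have hsum : ∑ q ∈ Finset.range n, ∑ i, e q i ≤ Fintype.card ι * (1 + 2 * C * (T - t)) := by
    rw [Finset.sum_comm]
    have := Finset.sum_le_sum fun (i : ι) (_ : i ∈ Finset.univ) =>
      X.sum_integral_increment_sq_le hmem hlt (hχ i) (hb i) hC0 (hC i)
    exact this.trans_eq (by rw [Finset.sum_const, Finset.card_univ, nsmul_eq_mul])
  calc ∑ q ∈ Finset.range n, w q * (β + K * ∑ i, (α + α⁻¹ * e q i))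
      = (∑ q ∈ Finset.range n, w q) * (β + K * (Fintype.card ι * α)) +
          ∑ q ∈ Finset.range n, w q * (K * α⁻¹ * ∑ i, e q i) := by
        rw [Finset.sum_mul, ← Finset.sum_add_distrib]
        refine Finset.sum_congr rfl fun q _ => ?_
        rw [Finset.sum_add_distrib, ← Finset.mul_sum]
        simp only [Finset.sum_const, Finset.card_univ, nsmul_eq_mul]
        ring
    _ ≤ (T - t) * (β + K * (Fintype.card ι * α)) +
          ∑ q ∈ Finset.range n, η * (K * α⁻¹ * ∑ i, e q i) := by
        refine add_le_add (mul_le_mul_of_nonneg_right hw (by positivity))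
          (Finset.sum_le_sum fun q hq => mul_le_mul_of_nonneg_right
            (hwη q (Finset.mem_range.1 hq)) ?_)
        have := Finset.sum_nonneg fun i (_ : i ∈ Finset.univ) => he q i
        positivity
    _ ≤ (T - t) * (β + K * (Fintype.card ι * α)) +
          η * (K * α⁻¹ * (Fintype.card ι * (1 + 2 * C * (T - t)))) := by
        rw [← Finset.mul_sum, ← Finset.mul_sum]
        gcongr
    _ = _ := by ring

end MVP

lemma exists_pos_mul_le {a ε : ℝ} (ha : 0 ≤ a) (hε : 0 < ε) : ∃ x > 0, x * a ≤ ε := by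
  refine ⟨ε / (a + 1), by positivity, ?_⟩
  rw [div_mul_eq_mul_div, div_le_iff₀ (by positivity)]
  nlinarith

lemma le_of_forall_lt_succ {n : ℕ} {τ : ℕ → ℝ} (h : ∀ q < n, τ q < τ (q + 1)) {a b : ℕ}
    (hab : a ≤ b) (hb : b ≤ n) : τ a ≤ τ b := by
  induction b, hab using Nat.le_induction with
  | base => exact le_rfl
  | succ b _ ih => exact (ih (by omega)).trans (h b hb).le

/-- For partitions `π = {t = t₁ < ... < t_N = T}` of `[t,T]`, with
`M̂_{t₁} = m` and `M̂_{t_q} = p^{t_{q−1},M_{t_{q−1}}}_{t_q}` for `q ≥ 2`, both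
`sup_{M ∈ 𝓜(t,m)} E[Σ_q (t_{q+1}−t_q) d₁(M_{t_q}, M̂_{t_q})]` and
`sup_{M ∈ 𝓜(t,m)} E[Σ_q (t_{q+1}−t_q) d₁(M_{t_{q+1}}, M̂_{t_{q+1}})]` tend to `0` as the
mesh `|π|` tends to `0`. -/
theorem d1_variation_vanishes (d : ℕ) (T t : ℝ) (ht : 0 ≤ t) (htT : t ≤ T)
    (m : Measure (Ed d)) (hm : MemP d 2 m) :
    ∀ ε > (0:ℝ), ∃ η > (0:ℝ), ∀ (N : ℕ) (τg : ℕ → ℝ), 2 ≤ N →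
      τg 0 = t → τg (N - 1) = T →
      (∀ q, q + 1 < N → τg q < τg (q + 1)) →
      (∀ q, q + 1 < N → τg (q + 1) - τg q < η) →
      ∀ X : MVP d T t m,
        (∫ ω, (∑ q ∈ Finset.range (N - 1),
            (τg (q + 1) - τg q) *
              wdist d 1 (X.M (τg q) ω)
                (if q = 0 then m else heatFlow d (τg (q - 1)) (τg q) (X.M (τg (q - 1)) ω)))
          ∂X.P) ≤ ε ∧
        (∫ ω, (∑ q ∈ Finset.range (N - 1),
            (τg (q + 1) - τg q) *
              wdist d 1 (X.M (τg (q + 1)) ω)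
                (heatFlow d (τg q) (τg (q + 1)) (X.M (τg q) ω)))
          ∂X.P) ≤ ε := by
  have hG := gaussMomentConst_nonneg (d := d)
  have hL : 0 ≤ T - t := sub_nonneg.2 htT
  have hm2 : 0 ≤ ∫ x, ‖x‖ ^ 2 ∂m := integral_nonneg fun x => by positivity
  have hB : 0 ≤ MVP.momentBound d T t m := by
    unfold MVP.momentBound
    positivity
  intro ε hε
  have hε4 : 0 < ε / 4 := by positivity
  set D := 1 + (3 * MVP.momentBound d T t m + 2 * gaussMomentConst d * (T - t)) with hD
  have hD0 : 0 ≤ D := by positivity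
  obtain ⟨δ, hδ, hδε⟩ := exists_pos_mul_le (mul_nonneg hL hD0) hε4
  obtain ⟨ι, _, χ, K, C, hK, hC0, hχ, hb, hC, hdist⟩ := exists_wdist_one_le d hδ
  obtain ⟨α, hα, hαε⟩ := exists_pos_mul_le (a := K * Fintype.card ι * (T - t))
    (by positivity) hε4
  set V := K * α⁻¹ * Fintype.card ι * (1 + 2 * C * (T - t)) with hV
  set b₀ := δ + K * (Fintype.card ι * 2) +
    δ * (MVP.momentBound d T t m + ∫ x, ‖x‖ ^ 2 ∂m) with hb₀
  have hV0 : 0 ≤ V := by positivity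
  have hb₀0 : 0 ≤ b₀ := by positivity
  obtain ⟨η, hη, hηε⟩ := exists_pos_mul_le (add_nonneg hV0 hb₀0) hε4
  refine ⟨η, hη, fun N τ hN hτ0 hτT hlt hmesh X => ?_⟩
  obtain ⟨n, rfl⟩ : ∃ n, N = n + 2 := ⟨N - 2, by omega⟩
  rw [show n + 2 - 1 = n + 1 by omega] at hτT ⊢
  replace hlt : ∀ q < n + 1, τ q < τ (q + 1) := fun q hq => hlt q (by omega)
  replace hmesh : ∀ q < n + 1, τ (q + 1) - τ q ≤ η := fun q hq => (hmesh q (by omega)).le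
  have hw : ∀ q < n + 1, 0 ≤ τ (q + 1) - τ q := fun q hq => sub_nonneg.2 (hlt q hq).le
  have hmem : ∀ q ≤ n + 1, τ q ∈ Icc t T := fun q hq =>
    ⟨hτ0 ▸ le_of_forall_lt_succ hlt q.zero_le hq, hτT ▸ le_of_forall_lt_succ hlt hq le_rfl⟩
  let b : ℕ → ℝ := fun q => δ * D + K * ∑ i,
    (α + α⁻¹ * ∫ ω, X.increment (χ i) (τ q) (τ (q + 1)) ω ^ 2 ∂X.P)
  have hmaj : ∀ q < n + 1, ∃ G : X.Ω → ℝ, Integrable G X.P ∧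
      (∀ᵐ ω ∂X.P, wdist d 1 (X.M (τ (q + 1)) ω)
        (heatFlow d (τ q) (τ (q + 1)) (X.M (τ q) ω)) ≤ G ω) ∧ ∫ ω, G ω ∂X.P ≤ b q := by
    intro q hq
    obtain ⟨G, hGi, hle, hGb⟩ := X.exists_majorant hm hK hδ.le hχ hb hdist
      (hmem q hq.le).1 (hlt q hq) (hmem (q + 1) hq).2 hα
    refine ⟨G, hGi, hle, hGb.trans_eq ?_⟩
    simp only [b, hD]
    ring
  have hδD : 0 ≤ δ * D := by positivity
  have hηV : 0 ≤ η * V := by positivity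
  have hηb : 0 ≤ η * b₀ := by positivity
  constructor
  · refine (integral_sum_mul_le (b := fun q => if q = 0 then b₀ else b (q - 1)) hw
      (fun q ω => wdist_nonneg _ _) fun q hq => ?_).trans ?_
    · rcases q with _ | q
      · simpa [hτ0] using X.exists_majorant_start hm hK hδ.le hb hdist htT
      · simpa using hmaj q (by omega)
    · rw [Finset.sum_range_succ']
      have hsum : ∑ q ∈ Finset.range n, (τ (q + 1 + 1) - τ (q + 1)) ≤ T - t := by
        rw [Finset.sum_range_sub (fun q => τ (q + 1))]
        exact sub_le_sub hτT.le (hmem 1 (by omega)).1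
      have h1 := X.sum_mul_le (n := n) (fun q hq => hmem q (by omega))
        (fun q hq => hlt q (by omega)) hχ hb hC0 hC hK hα hδD hη.le
        (fun q hq => hmesh (q + 1) (by omega)) hsum
      have h2 : (τ (0 + 1) - τ 0) * b₀ ≤ η * b₀ :=
        mul_le_mul_of_nonneg_right (hmesh 0 (by omega)) hb₀0
      simp only [Nat.add_eq_zero_iff, one_ne_zero, and_false, if_false, Nat.add_sub_cancel,
        if_true]
      linarith
  · refine (integral_sum_mul_le hw (fun q ω => wdist_nonneg _ _) hmaj).trans ?_
    have hsum : ∑ q ∈ Finset.range (n + 1), (τ (q + 1) - τ q) ≤ T - t := by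
      rw [Finset.sum_range_sub, hτT, hτ0]
    have h1 := X.sum_mul_le hmem hlt hχ hb hC0 hC hK hα hδD hη.le hmesh hsum
    linarith

end
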